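/- arXiv:1311.0855 — 3 statements merged into one kernel-verified Lean document; each statement's English description precedes it below -/
import Mathlib

section
/- Let δ ≥ 0 and let X be a δ-hyperbolic metric space. Then for all points x, x', y of X and every isometry g of X, d(gy,y) ≤ max{ d(gx,x) , d(gx',x') } + 2(x,x')_y + 6δ. -/
/-- The Gromov product `(y,z)_x = (d(x,y) + d(x,z) - d(y,z)) / 2`. -/
noncomputable def gprod {X : Type*} [MetricSpace X] (x y z : X) : ℝ :=
  (dist x y + dist x z - dist y z) / 2

/-- A metric space is `δ`-hyperbolic if `(x,z)_t ≥ min ((x,y)_t) ((y,z)_t) - δ`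
for all `x y z t`. -/
def DeltaHyp (X : Type*) [MetricSpace X] (δ : ℝ) : Prop :=
  ∀ x y z t : X, gprod t x z ≥ min (gprod t x y) (gprod t y z) - δ

/-- The four-point inequality for hyperbolic metric spaces. -/
theorem DeltaHyp.four_point {X : Type*} [MetricSpace X] {δ : ℝ} (h : DeltaHyp X δ)
    (a b c d : X) :
    dist a b + dist c d ≤ max (dist a c + dist b d) (dist a d + dist b c) + 2 * δ := by
  have key := h a c b d
  simp only [gprod, ge_iff_le, sub_le_iff_le_add, min_le_iff] at key
  rw [← sub_le_iff_le_add, le_max_iff]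
  rw [dist_comm d a, dist_comm d b, dist_comm d c, dist_comm c b] at key
  rcases key with key | key
  · left; linarith
  · right; linarith

/-- Crossing estimate: the distance from `g y` to `x`, controlled by the displacement of `x`. -/
theorem DeltaHyp.dist_image_add_dist_le {X : Type*} [MetricSpace X] {δ : ℝ} (h : DeltaHyp X δ)
    (x x' y : X) {g : X → X} (hg : Isometry g) :
    dist (g y) x + dist x x' ≤
      dist (g x) x + max (dist x y + dist x x') (dist x' y) + 2 * δ := by
  have h₁ := h.four_point (g y) x (g x) (g x')
  have h₂ := dist_triangle_left x (g x') (g x)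
  rw [hg.dist_eq, hg.dist_eq, hg.dist_eq, dist_comm y x, dist_comm y x', dist_comm x (g x)] at h₁
  rw [hg.dist_eq] at h₂
  rcases max_cases (dist x y + dist x (g x')) (dist x' y + dist (g x) x) with h₃ | h₃ <;>
  linarith [le_max_left (dist x y + dist x x') (dist x' y),
    le_max_right (dist x y + dist x x') (dist x' y)]

theorem quasi_convexity_of_displacement {X : Type*} [MetricSpace X]
    {δ : ℝ} (hδ : 0 ≤ δ) (hhyp : DeltaHyp X δ)
    (x x' y : X) (g : X → X) (hg : Isometry g) (hgs : Function.Surjective g) :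
    dist (g y) y ≤ max (dist (g x) x) (dist (g x') x') + 2 * gprod y x x' + 6 * δ := by
  have h₁ := hhyp.four_point (g y) y x x'
  have h₂ := hhyp.dist_image_add_dist_le x x' y hg
  have h₃ := hhyp.dist_image_add_dist_le x' x y hg
  have h₄ := dist_triangle_left y x x'
  have h₅ := dist_triangle_left y x' x
  have h₆ := le_max_left (dist (g x) x) (dist (g x') x')
  have h₇ := le_max_right (dist (g x) x) (dist (g x') x')
  rw [dist_comm x' x] at *
  simp only [gprod, dist_comm y] at *
  rcases max_cases (dist (g y) x + dist x' y) (dist (g y) x' + dist x y) with h | h <;>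
  rcases max_cases (dist x y + dist x x') (dist x' y) with h' | h' <;>
  rcases max_cases (dist x' y + dist x x') (dist x y) with h'' | h'' <;>
  linarith
end

section
/- Let δ > 0 and let X be a δ-hyperbolic length space. Let g be an isometry of X and let A_g = {x ∈ X : d(gx,x) < [g] + 8δ} be its axis, where [g] = inf_{x∈X} d(gx,x). Then for every point x ∈ X: (1) d(gx,x) ≥ 2·d(x, A_g) + [g] − 6δ; (2) for every A ≥ 0, if d(gx,x) ≤ [g] + A then d(x, A_g) ≤ A/2 + 3δ; and (3) A_g is 10δ-quasi-convex. -/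
/-- A length space: any two points are joined by a rectifiable path (here
parametrized by arclength, hence `1`-Lipschitz) of length at most `d(x,y) + ε`. -/
def IsLengthSpace (X : Type*) [MetricSpace X] : Prop :=
  ∀ x y : X, ∀ ε : ℝ, 0 < ε → ∃ L : ℝ, 0 ≤ L ∧ L ≤ dist x y + ε ∧
    ∃ γ : ℝ → X, γ 0 = x ∧ γ L = y ∧ LipschitzOnWith 1 γ (Set.Icc 0 L)

/-- `Y` is `α`-quasi-convex: `d(x,Y) ≤ (y,y')_x + α` for every `x ∈ X` and
`y, y' ∈ Y`. -/
def QConvex {X : Type*} [MetricSpace X] (α : ℝ) (Y : Set X) : Prop :=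
  ∀ x : X, ∀ y ∈ Y, ∀ y' ∈ Y, Metric.infDist x Y ≤ gprod x y y' + α

/-- The translation length of a self-map `g` of `X`. -/
noncomputable def translationLength {X : Type*} [MetricSpace X] (g : X → X) : ℝ :=
  ⨅ x : X, dist (g x) x

/-- The axis of `g`: the points moved by less than `[g] + 8δ`. -/
noncomputable def axisOf {X : Type*} [MetricSpace X] (g : X → X) (δ : ℝ) : Set X :=
  {x : X | dist (g x) x < translationLength g + 8 * δ}

section Hyperbolic

variable {X : Type*} [MetricSpace X] {δ : ℝ}

/-- The four-point form of hyperbolicity. -/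
lemma DeltaHyp.four_point_s13 (h : DeltaHyp X δ) (x y z t : X) :
    dist x z + dist y t ≤ max (dist x y + dist z t) (dist y z + dist x t) + 2 * δ := by
  have h1 := h x y z t
  simp only [gprod] at h1
  rw [dist_comm t x, dist_comm t y, dist_comm t z] at h1
  rcases min_cases ((dist x t + dist y t - dist x y) / 2)
      ((dist y t + dist z t - dist y z) / 2) with ⟨h2, -⟩ | ⟨h2, -⟩
  · have := le_max_left (dist x y + dist z t) (dist y z + dist x t)
    linarith
  · have := le_max_right (dist x y + dist z t) (dist y z + dist x t)
    linarith

lemma dist_le_of_lipschitzOn_Icc {γ : ℝ → X} {L s t : ℝ}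
    (hγ : LipschitzOnWith 1 γ (Set.Icc 0 L)) (hs : 0 ≤ s) (hst : s ≤ t) (ht : t ≤ L) :
    dist (γ s) (γ t) ≤ t - s := by
  have h := hγ.dist_le_mul s ⟨hs, hst.trans ht⟩ t ⟨hs.trans hst, ht⟩
  rw [Real.dist_eq, abs_sub_comm, abs_of_nonneg (sub_nonneg.2 hst)] at h
  simpa using h

/-- In a length space one finds almost-geodesic intermediate points. -/
lemma IsLengthSpace.exists_between (hlen : IsLengthSpace X) (y z : X) {s ε : ℝ}
    (hs : 0 ≤ s) (hsd : s ≤ dist y z) (hε : 0 < ε) :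
    ∃ p, dist y p ≤ s ∧ dist p z ≤ dist y z - s + ε := by
  obtain ⟨L, hL, hLd, γ, rfl, rfl, hγ⟩ := hlen y z ε hε
  have hd := dist_le_of_lipschitzOn_Icc hγ le_rfl hL le_rfl
  have h1 := dist_le_of_lipschitzOn_Icc hγ le_rfl hs (by linarith)
  have h2 := dist_le_of_lipschitzOn_Icc hγ hs (show s ≤ L by linarith) le_rfl
  exact ⟨γ s, by linarith, by linarith⟩

/-- If `y` almost minimizes the distance to `x` among the points lying almost on a geodesic
from `y` to `z`, then the Gromov product of `x` and `z` at `y` is small. -/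
lemma DeltaHyp.two_mul_gprod_le (h : DeltaHyp X δ) (hlen : IsLengthSpace X) (hδ : 0 ≤ δ)
    {x y z : X} {R c η : ℝ} (hη : 0 < η) (hc : dist y z < c)
    (hR : ∀ p, dist y p + dist p z < c → R ≤ dist x p) (hxy : dist x y ≤ R + η)
    (hyz : 2 * δ + 2 * η ≤ dist y z) :
    dist x y + dist y z - dist x z ≤ 4 * δ + 3 * η := by
  obtain ⟨p, hp1, hp2⟩ := hlen.exists_between y z (s := 2 * δ + 2 * η)
    (ε := min (η / 2) ((c - dist y z) / 2)) (by linarith) hyz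
    (lt_min (by linarith) (by linarith))
  have hm1 := min_le_left (η / 2) ((c - dist y z) / 2)
  have hm2 := min_le_right (η / 2) ((c - dist y z) / 2)
  have hRp := hR p (by linarith)
  have h4 := h.four_point_s13 x y p z
  rcases max_cases (dist x y + dist p z) (dist y p + dist x z) with ⟨h5, -⟩ | ⟨h5, -⟩ <;>
    rw [h5] at h4 <;> linarith

lemma translationLength_le (g : X → X) (x : X) : translationLength g ≤ dist (g x) x :=
  ciInf_le ⟨0, by rintro _ ⟨y, rfl⟩; exact dist_nonneg⟩ x

lemma translationLength_nonneg (g : X → X) : 0 ≤ translationLength g :=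
  Real.iInf_nonneg fun _ => dist_nonneg

lemma axisOf_nonempty [Nonempty X] (g : X → X) (hδ : 0 < δ) : (axisOf g δ).Nonempty :=
  exists_lt_of_ciInf_lt (show translationLength g < translationLength g + 8 * δ by linarith)

/-- A point off the axis has an almost-projection whose displacement is almost maximal among
points of the axis. -/
lemma exists_almost_projection [Nonempty X] (hlen : IsLengthSpace X) (hδ : 0 < δ) {g : X → X}
    (hg : Continuous g) {x : X} (hx : x ∉ axisOf g δ) {ε : ℝ} (hε : 0 < ε) :
    ∃ y ∈ axisOf g δ, dist x y ≤ Metric.infDist x (axisOf g δ) + ε ∧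
      translationLength g + 8 * δ - ε ≤ dist (g y) y := by
  obtain ⟨y₀, hy₀, hxy₀⟩ := (Metric.infDist_lt_iff (axisOf_nonempty g hδ)).1
    (show Metric.infDist x (axisOf g δ) < Metric.infDist x (axisOf g δ) + ε / 2 by linarith)
  obtain ⟨L, hL, hLd, γ, rfl, rfl, hγ⟩ := hlen x y₀ (ε / 2) (by linarith)
  replace hx : translationLength g + 8 * δ ≤ dist (g (γ 0)) (γ 0) := not_lt.1 hx
  replace hy₀ : dist (g (γ L)) (γ L) < translationLength g + 8 * δ := hy₀
  have hcont : ContinuousOn (fun t => dist (g (γ t)) (γ t)) (Set.Icc 0 L) :=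
    continuous_dist.comp_continuousOn
      ((hg.comp_continuousOn hγ.continuousOn).prodMk hγ.continuousOn)
  obtain ⟨t, ht, hft⟩ := intermediate_value_Icc' hL hcont
    (show max (dist (g (γ L)) (γ L)) (translationLength g + 8 * δ - ε) ∈ Set.Icc _ _ from
      ⟨le_max_left _ _, max_le (by linarith) (by linarith)⟩)
  simp only at hft
  refine ⟨γ t, ?_, ?_, ?_⟩
  · change dist (g (γ t)) (γ t) < _
    rw [hft]
    exact max_lt hy₀ (by linarith)
  · have := dist_le_of_lipschitzOn_Icc hγ le_rfl ht.1 ht.2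
    linarith [ht.2]
  · rw [hft]
    exact le_max_right _ _

lemma Isometry.mem_axisOf_iff {g : X → X} (hg : Isometry g) {p : X} :
    g p ∈ axisOf g δ ↔ p ∈ axisOf g δ := by
  simp only [axisOf, Set.mem_ofPred_eq, hg.dist_eq]

/-- A point almost on a geodesic from `y` to `g y`, with `y` in the axis, is in the axis. -/
lemma Isometry.mem_axisOf_of_between {g : X → X} (hg : Isometry g) {y p : X}
    (h : dist y p + dist p (g y) < translationLength g + 8 * δ) : p ∈ axisOf g δ := by
  have h1 := dist_triangle (g p) (g y) p
  rw [hg.dist_eq, dist_comm p y, dist_comm (g y) p] at h1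
  simp only [axisOf, Set.mem_ofPred_eq]
  linarith

/-- The displacement of an isometry grows linearly with the distance to its axis. -/
lemma DeltaHyp.infDist_axisOf_le [Nonempty X] (hδ : 0 < δ) (hhyp : DeltaHyp X δ)
    (hlen : IsLengthSpace X) {g : X → X} (hg : Isometry g) (hgs : Function.Surjective g) (x : X) :
    2 * Metric.infDist x (axisOf g δ) + translationLength g - 6 * δ ≤ dist (g x) x := by
  by_cases hx : x ∈ axisOf g δ
  · rw [Metric.infDist_zero_of_mem hx]
    linarith [translationLength_le g x]
  obtain ⟨y, hy, hxy, hLy⟩ :=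
    exists_almost_projection hlen hδ hg.continuous hx (show 0 < δ / 10 by linarith)
  have hnn := translationLength_nonneg g
  have hy' : dist (g y) y < translationLength g + 8 * δ := hy
  have hG : dist x y + dist y (g y) - dist x (g y) ≤ 4 * δ + 3 * (δ / 10) := by
    refine hhyp.two_mul_gprod_le hlen hδ.le (by linarith) (by rwa [dist_comm])
      (fun p hp => Metric.infDist_le_dist_of_mem (hg.mem_axisOf_of_between hp)) hxy ?_
    rw [dist_comm]
    linarith
  have hG' : dist (g x) (g y) + dist (g y) y - dist (g x) y ≤ 4 * δ + 3 * (δ / 10) := by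
    refine hhyp.two_mul_gprod_le (R := Metric.infDist x (axisOf g δ)) hlen hδ.le (by linarith) hy'
      (fun p hp => ?_) (by rwa [hg.dist_eq]) (by linarith)
    obtain ⟨q, rfl⟩ := hgs p
    rw [hg.dist_eq]
    refine Metric.infDist_le_dist_of_mem (hg.mem_axisOf_iff.1 (hg.mem_axisOf_of_between (y := y) ?_))
    rwa [dist_comm y, dist_comm _ (g y), add_comm]
  have hR : Metric.infDist x (axisOf g δ) ≤ dist x y := Metric.infDist_le_dist_of_mem hy
  have h4 := hhyp.four_point_s13 x y (g y) (g x)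
  rw [hg.dist_eq] at hG'
  rw [hg.dist_eq, dist_comm y x, dist_comm y (g y), dist_comm x (g x), dist_comm y (g x)] at h4
  rw [dist_comm y (g y)] at hG
  rcases max_cases (dist x y + dist x y) (dist (g y) y + dist (g x) x) with ⟨h5, -⟩ | ⟨h5, -⟩ <;>
    rw [h5] at h4 <;> linarith

end Hyperbolic

theorem axis_properties {X : Type*} [MetricSpace X] [Nonempty X]
    {δ : ℝ} (hδ : 0 < δ) (hhyp : DeltaHyp X δ) (hlen : IsLengthSpace X)
    (g : X → X) (hg : Isometry g) (hgs : Function.Surjective g) :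
    (∀ x : X, 2 * Metric.infDist x (axisOf g δ) + translationLength g - 6 * δ ≤
        dist (g x) x) ∧
    (∀ x : X, ∀ A : ℝ, 0 ≤ A → dist (g x) x ≤ translationLength g + A →
        Metric.infDist x (axisOf g δ) ≤ A / 2 + 3 * δ) ∧
    QConvex (10 * δ) (axisOf g δ) := by
  have key := hhyp.infDist_axisOf_le hδ hlen hg hgs
  refine ⟨key, fun x A _ h => by linarith [key x], fun x y hy y' hy' => ?_⟩
  simp only [axisOf, Set.mem_ofPred_eq] at hy hy'
  have h1 := key x
  have h4 := hhyp.four_point_s13 (g x) y x y'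
  have h2 := dist_triangle (g x) (g y) y
  have h3 := dist_triangle (g x) (g y') y'
  rw [hg.dist_eq] at h2 h3
  have h5 : max (dist (g x) y + dist x y') (dist y x + dist (g x) y') ≤
      dist x y + dist x y' + translationLength g + 8 * δ := by
    rw [dist_comm y x]
    exact max_le (by linarith) (by linarith)
  simp only [gprod]
  linarith
end

section
/- Let δ ≥ 0, let X be a δ-hyperbolic length space, let A ≥ 0, let u and v be isometries of X, and let x ∈ X. Assume: (1) 2(u^{ε}x, v^{ε'}x)_x < min{ d(ux,x), d(vx,x) } − A − 6δ for all ε, ε' ∈ {+1,−1}; (2) 2(ux, u⁻¹x)_x < d(ux,x) + A; and (3) 2(vx, v⁻¹x)_x < d(vx,x) + A. Then the isometries uv and vu freely generate a free subgroup of rank 2 of the isometry group of X; in particular the group generated by u and v contains a non-abelian free subgroup. -/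
theorem gprod_comm {X : Type*} [MetricSpace X] (x y z : X) : gprod x y z = gprod x z y := by
  simp only [gprod, dist_comm y z]; ring

theorem gprod_nonneg {X : Type*} [MetricSpace X] (x y z : X) : 0 ≤ gprod x y z := by
  have := dist_triangle y x z
  rw [dist_comm y x] at this
  simp only [gprod]; linarith

/-- If `t⁻¹ x` and `p` diverge at `x` while `y` follows `p` long enough, then applying `t` to `y`
makes it follow `t x` and controls its distance to `x`. -/
theorem DeltaHyp.gprod_lt_and_dist_lt {X : Type*} [MetricSpace X] {δ : ℝ} (hhyp : DeltaHyp X δ)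
    (t : X ≃ᵢ X) {x p y : X} {c : ℝ} (htp : gprod x (t⁻¹ x) p < c) (hpy : c + δ ≤ gprod x p y) :
    dist (t x) x - c - δ < gprod x (t x) (t y) ∧
      dist (t x) x + dist y x - 2 * c - 2 * δ < dist (t y) x := by
  have hmin := hhyp (t⁻¹ x) y p x
  have hlt : gprod x (t⁻¹ x) y < c + δ := by
    by_contra! h
    have := le_min h (hpy.trans_eq (gprod_comm x p y))
    linarith
  have htx : dist x (t⁻¹ x) = dist (t x) x := by
    rw [← t.dist_eq x (t⁻¹ x), IsometryEquiv.apply_inv_self]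
  have hty : dist (t⁻¹ x) y = dist (t y) x := by
    rw [← t.dist_eq (t⁻¹ x) y, IsometryEquiv.apply_inv_self, dist_comm]
  have htxy : dist (t x) (t y) = dist y x := by rw [t.dist_eq, dist_comm]
  simp only [gprod, htx, hty, dist_comm x y] at hlt
  refine ⟨?_, by linarith⟩
  simp only [gprod, htxy, dist_comm x (t x), dist_comm x (t y)]
  linarith

/-- The first of the two factors of the letter `p` in `u * v`, `v * u` and their inverses. -/
def firstFactor {G : Type*} [Group G] (u v : G) : Bool × Bool → G
  | (false, true) => u
  | (true, true) => v
  | (false, false) => v⁻¹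
  | (true, false) => u⁻¹

/-- The second of the two factors of the letter `p` in `u * v`, `v * u` and their inverses. -/
def secondFactor {G : Type*} [Group G] (u v : G) : Bool × Bool → G
  | (false, true) => v
  | (true, true) => u
  | (false, false) => u⁻¹
  | (true, false) => v⁻¹

theorem firstFactor_mul_secondFactor {G : Type*} [Group G] (u v : G) (p : Bool × Bool) :
    firstFactor u v p * secondFactor u v p =
      cond p.2 (cond p.1 (v * u) (u * v)) (cond p.1 (v * u) (u * v))⁻¹ := by
  rcases p with ⟨_ | _, _ | _⟩ <;> simp [firstFactor, secondFactor]

/-- A product of letters `f q * s q` moves `x` if at each junction of consecutive letters the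
Gromov product is less than `(d + A) / 2` for both adjacent displacements `d`, and inside each
letter it is less than `(m - A - 6 * δ) / 2`, where `m` bounds all displacements from below. -/
theorem DeltaHyp.dist_prod_pos {X α : Type*} [MetricSpace X] {δ : ℝ} (hδ : 0 ≤ δ)
    (hhyp : DeltaHyp X δ) {A m : ℝ} (hA : 0 ≤ A) (hm : A + 6 * δ < m) (x : X) (f s : α → X ≃ᵢ X)
    (hf : ∀ p, m ≤ dist (f p x) x) (hs : ∀ p, m ≤ dist (s p x) x)
    (hfs : ∀ p, 2 * gprod x ((f p)⁻¹ x) (s p x) < m - A - 6 * δ)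
    (R : α → α → Prop)
    (hR : ∀ p q, R p q → 2 * gprod x ((s p)⁻¹ x) (f q x) < dist (s p x) x + A ∧
      2 * gprod x ((s p)⁻¹ x) (f q x) < dist (f q x) x + A)
    (p : α) (L : List α) (hL : (p :: L).IsChain R) :
    dist (f p x) x - (m - A - 6 * δ) / 2 - δ <
        gprod x (f p x) (((p :: L).map fun q => f q * s q).prod x) ∧
      0 < dist (((p :: L).map fun q => f q * s q).prod x) x := by
  have step : ∀ (p : α) (y : X), (dist (s p x) x - A) / 2 - δ ≤ gprod x (s p x) (s p y) →
      -A - 2 * δ < dist (s p y) x →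
      dist (f p x) x - (m - A - 6 * δ) / 2 - δ < gprod x (f p x) (f p (s p y)) ∧
        0 < dist (f p (s p y)) x := by
    intro p y hy hpos
    have hsp := hs p
    have hfp := hf p
    obtain ⟨h, h'⟩ := hhyp.gprod_lt_and_dist_lt (f p) (x := x) (p := s p x) (y := s p y)
      (c := (m - A - 6 * δ) / 2) (by linarith [hfs p]) (by linarith)
    exact ⟨h, by linarith⟩
  induction L generalizing p with
  | nil =>
    have hsp := hs p
    have := step p x (by simp only [gprod, dist_self, dist_comm x (s p x)]; linarith)
      (by linarith)
    simpa using this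
  | cons q L ih =>
    rw [List.isChain_cons_cons] at hL
    obtain ⟨hq, hpos⟩ := ih q hL.2
    rw [List.map_cons, List.prod_cons, mul_assoc, IsometryEquiv.mul_apply,
      IsometryEquiv.mul_apply]
    generalize ((q :: L).map fun q => f q * s q).prod x = y at hq hpos
    obtain ⟨hR₁, hR₂⟩ := hR p q hL.1
    have hfq := hf q
    obtain ⟨h, h'⟩ := hhyp.gprod_lt_and_dist_lt (s p) (x := x) (p := f q x) (y := y)
      (c := (min (dist (s p x) x) (dist (f q x) x) + A) / 2)
      (by rcases min_choice (dist (s p x) x) (dist (f q x) x) with e | e <;> rw [e] <;> linarith)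
      (by linarith [min_le_right (dist (s p x) x) (dist (f q x) x)])
    have := min_le_left (dist (s p x) x) (dist (f q x) x)
    exact step p y (by linarith) (by linarith)

theorem free_subgroup_criterion {X : Type*} [MetricSpace X]
    {δ : ℝ} (hδ : 0 ≤ δ) (hhyp : DeltaHyp X δ) (hlen : IsLengthSpace X)
    (A : ℝ) (hA : 0 ≤ A) (u v : X ≃ᵢ X) (x : X)
    (h1 : 2 * gprod x (u x) (v x) < min (dist (u x) x) (dist (v x) x) - A - 6 * δ)
    (h2 : 2 * gprod x (u x) (v⁻¹ x) < min (dist (u x) x) (dist (v x) x) - A - 6 * δ)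
    (h3 : 2 * gprod x (u⁻¹ x) (v x) < min (dist (u x) x) (dist (v x) x) - A - 6 * δ)
    (h4 : 2 * gprod x (u⁻¹ x) (v⁻¹ x) < min (dist (u x) x) (dist (v x) x) - A - 6 * δ)
    (h5 : 2 * gprod x (u x) (u⁻¹ x) < dist (u x) x + A)
    (h6 : 2 * gprod x (v x) (v⁻¹ x) < dist (v x) x + A) :
    ∃ φ : FreeGroup Bool →* (X ≃ᵢ X), Function.Injective φ ∧
      φ (FreeGroup.of false) = u * v ∧ φ (FreeGroup.of true) = v * u ∧
      φ.range ≤ Subgroup.closure {u, v} := by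
  have hu : u ∈ Subgroup.closure {u, v} := Subgroup.subset_closure (by simp)
  have hv : v ∈ Subgroup.closure {u, v} := Subgroup.subset_closure (by simp)
  refine ⟨FreeGroup.lift fun b => cond b (v * u) (u * v), ?_, by simp, by simp, ?_⟩
  · have dist_inv : ∀ g : X ≃ᵢ X, dist (g⁻¹ x) x = dist (g x) x := fun g => by
      rw [← g.dist_eq (g⁻¹ x) x, IsometryEquiv.apply_inv_self, dist_comm]
    rw [injective_iff_map_eq_one]
    intro g hg
    by_contra hne
    obtain ⟨p, L, hpL⟩ := List.exists_cons_of_ne_nil (mt FreeGroup.toWord_eq_nil_iff.1 hne)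
    have hred : FreeGroup.IsReduced (p :: L) := hpL ▸ FreeGroup.isReduced_toWord
    rw [← FreeGroup.mk_toWord (x := g), hpL, FreeGroup.lift_mk] at hg
    simp only [← firstFactor_mul_secondFactor] at hg
    have hleft := min_le_left (dist (u x) x) (dist (v x) x)
    have hright := min_le_right (dist (u x) x) (dist (v x) x)
    have h1' := gprod_comm x (u x) (v x)
    have h2' := gprod_comm x (u x) (v⁻¹ x)
    have h3' := gprod_comm x (u⁻¹ x) (v x)
    have h4' := gprod_comm x (u⁻¹ x) (v⁻¹ x)
    have h5' := gprod_comm x (u x) (u⁻¹ x)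
    have h6' := gprod_comm x (v x) (v⁻¹ x)
    have hpos := (hhyp.dist_prod_pos hδ hA (m := min (dist (u x) x) (dist (v x) x))
      (by linarith [gprod_nonneg x (u x) (v x)]) x (firstFactor u v) (secondFactor u v)
      (by rintro ⟨_ | _, _ | _⟩ <;> simp only [firstFactor, dist_inv] <;> assumption)
      (by rintro ⟨_ | _, _ | _⟩ <;> simp only [secondFactor, dist_inv] <;> assumption)
      (by
        rintro ⟨_ | _, _ | _⟩ <;> simp only [firstFactor, secondFactor, inv_inv] <;> linarith)
      (fun a b => a.1 = b.1 → a.2 = b.2)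
      (by
        rintro ⟨_ | _, _ | _⟩ ⟨_ | _, _ | _⟩ h <;>
          simp only [firstFactor, secondFactor, inv_inv, dist_inv] <;>
          first
          | exact absurd (h rfl) (by decide)
          | constructor <;> linarith)
      p L hred).2
    rw [hg] at hpos
    simp at hpos
  · rw [FreeGroup.range_lift_eq_closure, Subgroup.closure_le]
    rintro _ ⟨_ | _, rfl⟩
    · exact mul_mem hu hv
    · exact mul_mem hv hu
end
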